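/- Pointwise coercivity of the spin-diffusion form (integrand version of the continuous coercivity lemma): Let D₀, D_*, β, β' ∈ ℝ with D₀ ≥ D_* > 0 and 0 < β < 1, 0 < β' < 1. Then for every m ∈ ℝ³ with ‖m‖ = 1, every matrix G ∈ Matrix (Fin 3) (Fin 3) ℝ, and every s ∈ ℝ³, one has D₀ · ( ‖G‖_F² − β β' · Σ_{j,k} m_j (Gᵀ m)_k G_{jk} + ‖s‖² + ⟪s ×₃ m, s⟫ ) ≥ (1 − β β') D_* · ( ‖G‖_F² + ‖s‖² ). -/

import Mathlib

open scoped RealInnerProductSpace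

/-- The cross product on `ℝ³ = EuclideanSpace ℝ (Fin 3)`. -/
noncomputable def cross3 (a b : EuclideanSpace ℝ (Fin 3)) : EuclideanSpace ℝ (Fin 3) :=
  (EuclideanSpace.equiv (Fin 3) ℝ).symm
    (crossProduct ((EuclideanSpace.equiv (Fin 3) ℝ) a) ((EuclideanSpace.equiv (Fin 3) ℝ) b))

theorem inner_cross3_self (a b : EuclideanSpace ℝ (Fin 3)) : ⟪cross3 a b, a⟫ = 0 := by
  simp [cross3, PiLp.inner_apply, Fin.sum_univ_three, cross_apply]
  ring

/-- The Frobenius product of `m ⊗ (Gᵀ m)` with `G` is `‖Gᵀ m‖²`, which Cauchy–Schwarz bounds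
columnwise. -/
theorem sum_mul_transpose_mulVec_mul_le {ι κ : Type*} [Fintype ι] [Fintype κ]
    (m : ι → ℝ) (G : Matrix ι κ ℝ) :
    ∑ j, ∑ k, m j * G.transpose.mulVec m k * G j k ≤ (∑ j, m j ^ 2) * ∑ j, ∑ k, G j k ^ 2 := by
  have sum_col (k : κ) : ∑ j, m j * G.transpose.mulVec m k * G j k = (∑ j, m j * G j k) ^ 2 := by
    simp only [Matrix.mulVec, dotProduct, Matrix.transpose_apply, sq, Finset.sum_mul]
    refine Finset.sum_congr rfl fun j _ => ?_
    simp only [mul_comm (G _ k)]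
    ring
  rw [Finset.sum_comm, Finset.sum_comm (f := fun j k => G j k ^ 2), Finset.mul_sum]
  refine Finset.sum_le_sum fun k _ => ?_
  rw [sum_col]
  exact Finset.sum_mul_sq_le_sq_mul_sq _ _ _

/-- Pointwise coercivity of the spin-diffusion bilinear form. -/
theorem pointwise_coercivity_spin_diffusion
    (D0 Dstar β β' : ℝ) (hD : Dstar ≤ D0) (hDstar : 0 < Dstar)
    (hβ0 : 0 < β) (hβ1 : β < 1) (hβ'0 : 0 < β') (hβ'1 : β' < 1)
    (m : EuclideanSpace ℝ (Fin 3)) (hm : ‖m‖ = 1)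
    (G : Matrix (Fin 3) (Fin 3) ℝ) (s : EuclideanSpace ℝ (Fin 3)) :
    D0 * ((∑ j : Fin 3, ∑ k : Fin 3, G j k ^ 2)
        - β * β' * (∑ j : Fin 3, ∑ k : Fin 3, m j * G.transpose.mulVec (fun i => m i) k * G j k)
        + ‖s‖ ^ 2 + ⟪cross3 s m, s⟫)
      ≥ (1 - β * β') * Dstar * ((∑ j : Fin 3, ∑ k : Fin 3, G j k ^ 2) + ‖s‖ ^ 2) := by
  have hβ : 0 < β * β' := mul_pos hβ0 hβ'0
  have hβ_lt : β * β' < 1 := mul_lt_one_of_nonneg_of_lt_one_left hβ0.le hβ1 hβ'1.le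
  have hm_sq : ∑ j, m j ^ 2 = 1 := by
    rw [← EuclideanSpace.real_norm_sq_eq, hm, one_pow]
  have hF := sum_mul_transpose_mulVec_mul_le (fun i => m i) G
  rw [hm_sq, one_mul] at hF
  have hG : 0 ≤ ∑ j : Fin 3, ∑ k : Fin 3, G j k ^ 2 := by positivity
  rw [inner_cross3_self, add_zero]
  set F := ∑ j : Fin 3, ∑ k : Fin 3, G j k ^ 2
  set T := ∑ j : Fin 3, ∑ k : Fin 3, m j * G.transpose.mulVec (fun i => m i) k * G j k
  have hlower : (1 - β * β') * (F + ‖s‖ ^ 2) ≤ F - β * β' * T + ‖s‖ ^ 2 := by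
    nlinarith [mul_le_mul_of_nonneg_left hF hβ.le, mul_nonneg hβ.le (sq_nonneg ‖s‖)]
  have hnonneg : 0 ≤ (1 - β * β') * (F + ‖s‖ ^ 2) :=
    mul_nonneg (sub_nonneg.mpr hβ_lt.le) (by positivity)
  calc (1 - β * β') * Dstar * (F + ‖s‖ ^ 2)
      = Dstar * ((1 - β * β') * (F + ‖s‖ ^ 2)) := by ring
    _ ≤ D0 * (F - β * β' * T + ‖s‖ ^ 2) :=
      mul_le_mul hD hlower hnonneg (hDstar.le.trans hD)
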